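/- arXiv:1805.08164 — 2 statements merged into one kernel-verified Lean document; each statement's English description precedes it below -/
import Mathlib

section
/- Assume 𝔱 = ω₁. Then there exists a partial order which is stationarily Knaster but does not have stationary precaliber ω₁. In particular, this holds under CH. -/
noncomputable section

open Set

/-- The first uncountable ordinal. -/
def omega1 : Ordinal.{0} := (Cardinal.aleph 1).ord

/-- `C` is a closed unbounded subset of `ω₁`. -/
def IsClubOmega1 (C : Set Ordinal) : Prop :=
  C ⊆ Set.Iio omega1 ∧
  (∀ α < omega1, ∃ β ∈ C, α < β) ∧
  (∀ α < omega1, α ≠ 0 → (∀ β < α, ∃ γ ∈ C, β < γ ∧ γ < α) → α ∈ C)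

/-- `S` is a stationary subset of `ω₁`. -/
def IsStationaryOmega1 (S : Set Ordinal) : Prop :=
  S ⊆ Set.Iio omega1 ∧ ∀ C, IsClubOmega1 C → (S ∩ C).Nonempty

/-- Two conditions are compatible if they have a common lower bound. -/
def Compat {P : Type*} [PartialOrder P] (p q : P) : Prop := ∃ r, r ≤ p ∧ r ≤ q

/-- A set of conditions is linked if its elements are pairwise compatible. -/
def Linked {P : Type*} [PartialOrder P] (B : Set P) : Prop :=
  ∀ p ∈ B, ∀ q ∈ B, Compat p q

/-- A set of conditions is centered if each of its finite subsets has a lower bound. -/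
def Centered {P : Type*} [PartialOrder P] (B : Set P) : Prop :=
  ∀ F : Finset P, ↑F ⊆ B → ∃ r : P, ∀ p ∈ F, r ≤ p

/-- `P` is stationarily Knaster. -/
def StationarilyKnaster (P : Type*) [PartialOrder P] : Prop :=
  ∀ S : Set Ordinal, IsStationaryOmega1 S → ∀ p : Ordinal → P,
    ∃ T ⊆ S, IsStationaryOmega1 T ∧ ∀ i ∈ T, ∀ j ∈ T, Compat (p i) (p j)

/-- `P` has stationary precaliber `ω₁`. -/
def StationaryPrecaliber (P : Type*) [PartialOrder P] : Prop :=
  ∀ S : Set Ordinal, IsStationaryOmega1 S → ∀ p : Ordinal → P,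
    ∃ T ⊆ S, IsStationaryOmega1 T ∧ Centered (p '' T)

/-- `P` is Knaster: every family of ℵ₁-many conditions has an uncountable
linked subfamily. -/
def Knaster (P : Type*) [PartialOrder P] : Prop :=
  ∀ p : Ordinal → P, ∃ X ⊆ Set.Iio omega1, ¬ X.Countable ∧
    ∀ i ∈ X, ∀ j ∈ X, Compat (p i) (p j)

/-- A tower: a family of infinite subsets of ω, well-ordered and strictly
decreasing under reverse almost-inclusion, with no pseudo-intersection. -/
def IsTowerFamily (𝒯 : Set (Set ℕ)) : Prop :=
  (∀ A ∈ 𝒯, A.Infinite) ∧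
  IsWellOrder ↥𝒯 (fun A B =>
    ((B : Set ℕ) \ (A : Set ℕ)).Finite ∧ ¬ ((A : Set ℕ) \ (B : Set ℕ)).Finite) ∧
  ¬ ∃ A : Set ℕ, A.Infinite ∧ ∀ B ∈ 𝒯, (A \ B).Finite

theorem omega1_eq : omega1 = Ordinal.omega 1 := Cardinal.ord_aleph 1

/-- A countable supremum of ordinals below `ω₁` is below `ω₁`. -/
theorem iSup_lt_omega1 {ι : Type*} [Countable ι] {f : ι → Ordinal.{0}}
    (hf : ∀ i, f i < omega1) : ⨆ i, f i < omega1 := by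
  rw [omega1_eq] at hf ⊢
  exact Ordinal.iSup_lt_omega_one hf

theorem bddAbove_of_lt_omega1 {ι : Type*} {f : ι → Ordinal.{0}}
    (hf : ∀ i, f i < omega1) : BddAbove (range f) :=
  ⟨omega1, by rintro _ ⟨i, rfl⟩; exact (hf i).le⟩

theorem add_one_lt_omega1 {a : Ordinal} (ha : a < omega1) : a + 1 < omega1 := by
  rw [omega1_eq] at ha ⊢
  exact (Cardinal.isSuccLimit_omega 1).add_one_lt ha

/-- The intersection of countably many clubs of `ω₁` is a club. -/
theorem IsClubOmega1.iInter {ι : Type*} [Countable ι] [Nonempty ι] {C : ι → Set Ordinal}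
    (hC : ∀ n, IsClubOmega1 (C n)) : IsClubOmega1 (⋂ n, C n) := by
  refine ⟨fun x hx => (hC (Classical.arbitrary ι)).1 (mem_iInter.1 hx _), fun α hα => ?_,
    fun α hα h0 h => mem_iInter.2 fun n => (hC n).2.2 α hα h0 fun β hβ => ?_⟩
  · choose next hnext hlt using fun n => (hC n).2.1
    let step : Iio omega1 → Iio omega1 := fun b =>
      ⟨⨆ n, next n b.1 b.2, iSup_lt_omega1 fun n => (hC n).1 (hnext n b.1 b.2)⟩
    have hstep (n : ι) (b : Iio omega1) : next n b.1 b.2 ≤ (step b).1 :=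
      le_ciSup (bddAbove_of_lt_omega1 fun n => (hC n).1 (hnext n b.1 b.2)) n
    let a : ℕ → Iio omega1 := fun k => step^[k] ⟨α, hα⟩
    have ha (k : ℕ) : a (k + 1) = step (a k) := Function.iterate_succ_apply' _ _ _
    have hbdd : BddAbove (range fun k => (a k).1) := bddAbove_of_lt_omega1 fun k => (a k).2
    have hmono (k : ℕ) : (a k).1 < (a (k + 1)).1 := by
      rw [ha]
      exact (hlt (Classical.arbitrary ι) _ (a k).2).trans_le (hstep _ _)
    have hsup (k : ℕ) : (a k).1 < ⨆ k, (a k).1 := (hmono k).trans_le (le_ciSup hbdd (k + 1))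
    refine ⟨⨆ k, (a k).1, mem_iInter.2 fun n => ?_, hsup 0⟩
    refine (hC n).2.2 _ (iSup_lt_omega1 fun k => (a k).2) (ne_bot_of_gt (hsup 0)) fun β hβ => ?_
    obtain ⟨k, hk⟩ := (lt_ciSup_iff hbdd).1 hβ
    refine ⟨next n (a k).1 (a k).2, hnext _ _ _, hk.trans (hlt _ _ _), ?_⟩
    exact (hstep n (a k)).trans_lt (ha k ▸ hsup (k + 1))
  · obtain ⟨γ, hγ, h⟩ := h β hβ
    exact ⟨γ, mem_iInter.1 hγ n, h⟩

/-- If a stationary set is split into countably many pieces, one of them is stationary. -/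
theorem IsStationaryOmega1.exists_fiber {κ : Type*} [Countable κ] {S : Set Ordinal}
    (hS : IsStationaryOmega1 S) (c : Ordinal → κ) :
    ∃ n, IsStationaryOmega1 {i ∈ S | c i = n} := by
  by_contra! h
  have : ∀ n, ∃ C, IsClubOmega1 C ∧ ¬ ({i ∈ S | c i = n} ∩ C).Nonempty := by
    intro n
    by_contra! hn
    exact h n ⟨fun x hx => hS.1 hx.1, hn⟩
  choose C hC hne using this
  have : Nonempty κ := ⟨c 0⟩
  obtain ⟨x, hx, hxC⟩ := hS.2 _ (IsClubOmega1.iInter hC)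
  exact hne (c x) ⟨x, ⟨hx, rfl⟩, mem_iInter.1 hxC _⟩

/-- A stationary subset of `ω₁` is unbounded. -/
theorem IsStationaryOmega1.exists_gt {S : Set Ordinal} (hS : IsStationaryOmega1 S)
    {α : Ordinal} (hα : α < omega1) : ∃ β ∈ S, α < β := by
  have hC : IsClubOmega1 (Ioo α omega1) := by
    refine ⟨fun x hx => hx.2, fun β hβ => ?_, fun β hβ h0 h => ?_⟩
    · have := add_one_lt_omega1 (max_lt hα hβ)
      have h1 := Order.lt_add_one_iff.2 (le_refl (max α β))
      exact ⟨max α β + 1, ⟨(le_max_left _ _).trans_lt h1, this⟩, (le_max_right _ _).trans_lt h1⟩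
    · obtain ⟨γ, hγ, -, h⟩ := h 0 (pos_iff_ne_zero.2 h0)
      exact ⟨hγ.1.trans h, hβ⟩
  obtain ⟨β, hβ, h⟩ := hS.2 _ hC
  exact ⟨β, hβ, h.1⟩

theorem isStationaryOmega1_Iio : IsStationaryOmega1 (Iio omega1) := by
  refine ⟨Subset.rfl, fun C hC => ?_⟩
  have h0 : (0 : Ordinal) < omega1 := omega1_eq ▸ Ordinal.omega_pos 1
  obtain ⟨β, hβ, -⟩ := hC.2.1 0 h0
  exact ⟨β, hC.1 hβ, hβ⟩

/-- A partial order that is a countable union of linked sets is stationarily Knaster. -/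
theorem stationarilyKnaster_of_countable_linked {P : Type*} [PartialOrder P] {κ : Type*}
    [Countable κ] (c : P → κ) (hc : ∀ p q, c p = c q → Compat p q) : StationarilyKnaster P := by
  intro S hS p
  obtain ⟨n, hn⟩ := hS.exists_fiber (c ∘ p)
  exact ⟨_, sep_subset _ _, hn, fun i hi j hj => hc _ _ (hi.2.trans hj.2.symm)⟩

/-- An enumeration in type `ω₁` of a tower. -/
structure IsOmega1Tower (T : Ordinal.{0} → Set ℕ) : Prop where
  infinite : ∀ i < omega1, (T i).Infinite
  almost_subset : ∀ i j, i ≤ j → j < omega1 → (T j \ T i).Finite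
  no_pseudoIntersection : ¬ ∃ A : Set ℕ, A.Infinite ∧ ∀ i < omega1, (A \ T i).Finite

/-- Almost inclusion is transitive. -/
theorem finite_diff_trans {A B C : Set ℕ} (h₁ : (A \ B).Finite) (h₂ : (B \ C).Finite) :
    (A \ C).Finite :=
  (h₁.union h₂).subset (sdiff_triangle A B C)

/-- A cofinal subfamily of a tower is a tower. -/
theorem IsTowerFamily.of_cofinal {𝒯 𝒮 : Set (Set ℕ)} (h𝒯 : IsTowerFamily 𝒯) (hsub : 𝒮 ⊆ 𝒯)
    (hcof : ∀ A ∈ 𝒯, ∃ B ∈ 𝒮, (B \ A).Finite) : IsTowerFamily 𝒮 := by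
  obtain ⟨hinf, hwo, hps⟩ := h𝒯
  refine ⟨fun A hA => hinf A (hsub hA), ?_, ?_⟩
  · let r : ↥𝒯 → ↥𝒯 → Prop := fun A B =>
      ((B : Set ℕ) \ (A : Set ℕ)).Finite ∧ ¬ ((A : Set ℕ) \ (B : Set ℕ)).Finite
    have : IsWellOrder ↥𝒯 r := hwo
    exact (RelEmbedding.preimage ⟨inclusion hsub, inclusion_injective hsub⟩ r).isWellOrder
  · rintro ⟨A, hA, h⟩
    refine hps ⟨A, hA, fun B hB => ?_⟩
    obtain ⟨D, hD, hDB⟩ := hcof B hB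
    exact finite_diff_trans (h D hD) hDB

/-- A well-ordered family of size and cofinality `ℵ₁` with no pseudo-intersection yields a tower
of order type `ω₁`. -/
theorem exists_isOmega1Tower_of_wellOrder {α : Type} [LinearOrder α] [WellFoundedLT α]
    (f : α → Set ℕ) (hinf : ∀ a, (f a).Infinite) (hle : ∀ a b, a ≤ b → (f b \ f a).Finite)
    (hps : ¬ ∃ A : Set ℕ, A.Infinite ∧ ∀ a, (A \ f a).Finite)
    (hcard : Cardinal.mk α ≤ Cardinal.aleph 1)
    (hcof : ∀ s : Set α, IsCofinal s → Cardinal.aleph 1 ≤ Cardinal.mk s) :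
    ∃ T : Ordinal.{0} → Set ℕ, IsOmega1Tower T := by
  classical
  obtain ⟨s, hs, htype⟩ := Ordinal.exists_ord_cof_eq α
  rw [((Order.cof_le_cardinalMk α).trans hcard).antisymm (Order.le_cof_iff.2 hcof)] at htype
  let e : Iio (Ordinal.type (α := ↥s) (· < ·)) → ↥s := Ordinal.enum (· < ·)
  have hmem {i : Ordinal} (hi : i < omega1) : i < Ordinal.type (α := ↥s) (· < ·) :=
    htype ▸ hi
  let T : Ordinal.{0} → Set ℕ := fun i => if hi : i < omega1 then f (e ⟨i, hmem hi⟩) else univ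
  have hT {i : Ordinal} (hi : i < omega1) : T i = f (e ⟨i, hmem hi⟩) := dif_pos hi
  refine ⟨T, fun i hi => hT hi ▸ hinf _, fun i j hij hj => ?_, ?_⟩
  · rw [hT hj, hT (hij.trans_lt hj)]
    obtain rfl | h := hij.eq_or_lt
    · simp
    · exact hle _ _ (le_of_lt (Ordinal.enum_lt_enum (r := ((· < ·) : ↥s → ↥s → Prop)).2 h))
  · rintro ⟨A, hA, h⟩
    refine hps ⟨A, hA, fun b => ?_⟩
    obtain ⟨d, hd, hbd⟩ := hs b
    obtain ⟨⟨i, hi⟩, hid⟩ := (Ordinal.enum ((· < ·) : ↥s → ↥s → Prop)).surjective ⟨d, hd⟩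
    have hi' : i < omega1 := by rw [omega1, ← htype]; exact hi
    have h1 := h i hi'
    have h2 : T i = f d := by
      rw [hT hi']
      exact congrArg (fun x : ↥s => f x.1) hid
    rw [h2] at h1
    exact finite_diff_trans h1 (hle b d hbd)

/-- If `𝔱 = ω₁`, some tower has order type `ω₁`. -/
theorem exists_isOmega1Tower
    (hexists : ∃ 𝒯 : Set (Set ℕ), IsTowerFamily 𝒯 ∧ Cardinal.mk ↥𝒯 = Cardinal.aleph 1)
    (hleast : ∀ 𝒯 : Set (Set ℕ), IsTowerFamily 𝒯 → Cardinal.aleph 1 ≤ Cardinal.mk ↥𝒯) :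
    ∃ T : Ordinal.{0} → Set ℕ, IsOmega1Tower T := by
  classical
  obtain ⟨𝒯, h𝒯, hcard⟩ := hexists
  let r : ↥𝒯 → ↥𝒯 → Prop := fun A B =>
    ((B : Set ℕ) \ (A : Set ℕ)).Finite ∧ ¬ ((A : Set ℕ) \ (B : Set ℕ)).Finite
  have hwo : IsWellOrder ↥𝒯 r := h𝒯.2.1
  have hle {A B : ↥𝒯} (h : A = B ∨ r A B) : ((B : Set ℕ) \ (A : Set ℕ)).Finite := by
    obtain rfl | h := h
    · simp
    · exact h.1
  refine @exists_isOmega1Tower_of_wellOrder ↥𝒯 (linearOrderOfSTO r) ⟨hwo.wf⟩ Subtype.val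
    (fun A => h𝒯.1 A A.2) (fun A B h => hle h) (fun ⟨A, hA, h⟩ => h𝒯.2.2 ⟨A, hA, fun B hB =>
      h ⟨B, hB⟩⟩) hcard.le fun s hs => ?_
  rw [← Cardinal.mk_image_eq Subtype.val_injective]
  refine hleast _ (h𝒯.of_cofinal (by simp) fun A hA => ?_)
  obtain ⟨B, hB, hAB⟩ := hs ⟨A, hA⟩
  exact ⟨B, ⟨B, hB, rfl⟩, hle hAB⟩

/-- The least element of `A` that is at least `k`. -/
def nextMem (A : Set ℕ) (k : ℕ) : ℕ := sInf {x | x ∈ A ∧ k ≤ x}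

theorem nextMem_spec {A : Set ℕ} (hA : A.Infinite) (k : ℕ) : nextMem A k ∈ A ∧ k ≤ nextMem A k :=
  Nat.sInf_mem (s := {x | x ∈ A ∧ k ≤ x}) <| by
    obtain ⟨x, hx, h⟩ := hA.exists_gt k
    exact ⟨x, hx, h.le⟩

theorem nextMem_le {A : Set ℕ} {k x : ℕ} (hx : x ∈ A) (hk : k ≤ x) : nextMem A k ≤ x :=
  Nat.sInf_le ⟨hx, hk⟩

/-- The values at `k` of the next-element functions of the sets `T i`, `i ∈ F`. -/
def nextValues (T : Ordinal.{0} → Set ℕ) (F : Finset Ordinal.{0}) (k : ℕ) : Finset ℕ :=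
  F.image fun i => nextMem (T i) k

/-- Two values at `k` of the next-element functions suffice to meet all the sets `T i`, `i ∈ F`. -/
def HasPairAt (T : Ordinal.{0} → Set ℕ) (F : Finset Ordinal.{0}) (k : ℕ) : Prop :=
  ∃ a ∈ nextValues T F k, ∃ b ∈ nextValues T F k, ∀ i ∈ F, a ∈ T i ∨ b ∈ T i

/-- A finite set of indices is a condition if, for every `k`, the next-element functions take at
most `k + 1` values at `k`, and two such values suffice to meet all the sets of any nonempty
subfamily. -/
def IsCondition (T : Ordinal.{0} → Set ℕ) (F : Finset Ordinal.{0}) : Prop :=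
  ↑F ⊆ Iio omega1 ∧ ∀ k, (nextValues T F k).card ≤ k + 1 ∧
    ∀ H ⊆ F, H.Nonempty → HasPairAt T H k

theorem IsCondition.mono {T : Ordinal.{0} → Set ℕ} {F G : Finset Ordinal.{0}}
    (hG : IsCondition T G) (h : F ⊆ G) : IsCondition T F :=
  ⟨(Finset.coe_subset.2 h).trans hG.1, fun k =>
    ⟨(Finset.card_le_card (Finset.image_subset_image h)).trans (hG.2 k).1,
      fun H hH => (hG.2 k).2 H (hH.trans h)⟩⟩

theorem isCondition_singleton {T : Ordinal.{0} → Set ℕ} (hT : IsOmega1Tower T) {i : Ordinal}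
    (hi : i < omega1) : IsCondition T {i} := by
  refine ⟨by simpa using hi, fun k => ⟨by simp [nextValues], fun H hH hne => ?_⟩⟩
  rw [hne.subset_singleton_iff.1 hH]
  refine ⟨nextMem (T i) k, by simp [nextValues], nextMem (T i) k, by simp [nextValues], ?_⟩
  simpa using (nextMem_spec (hT.infinite i hi) k).1

/-- Beyond some point, a finite subfamily of a tower is decreasing. -/
theorem IsOmega1Tower.exists_tail {T : Ordinal.{0} → Set ℕ} (hT : IsOmega1Tower T)
    {F : Finset Ordinal.{0}} (hF : ↑F ⊆ Iio omega1) :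
    ∃ m, ∀ i ∈ F, ∀ j ∈ F, i ≤ j → ∀ x, m ≤ x → x ∈ T j → x ∈ T i := by
  have hfin : (⋃ p ∈ (F ×ˢ F).filter (fun p => p.1 ≤ p.2), T p.2 \ T p.1).Finite :=
    ((F ×ˢ F).filter _).finite_toSet.biUnion fun p hp => by
      obtain ⟨hp, hle⟩ := Finset.mem_filter.1 hp
      exact hT.almost_subset _ _ hle (hF (Finset.mem_product.1 hp).2)
  obtain ⟨m, hm⟩ := hfin.bddAbove
  refine ⟨m + 1, fun i hi j hj hij x hx hxT => ?_⟩
  by_contra hxi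
  have := hm (mem_iUnion₂.2 ⟨(i, j),
    Finset.mem_filter.2 ⟨Finset.mem_product.2 ⟨hi, hj⟩, hij⟩, hxT, hxi⟩)
  omega

open Classical in
/-- The traces on `[0, M)` of the sets `T i`, `i ∈ F`. -/
def traces (T : Ordinal.{0} → Set ℕ) (F : Finset Ordinal.{0}) (M : ℕ) : Finset (Finset ℕ) :=
  F.image fun i => (Finset.range M).filter (· ∈ T i)

/-- `m` bounds twice the size of `F` and the point where the sets `T i`, `i ∈ F`, start to be
decreasing, and `M` bounds the next-element functions below `m`. -/
def IsBound (T : Ordinal.{0} → Set ℕ) (F : Finset Ordinal.{0}) (m M : ℕ) : Prop :=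
  2 * F.card ≤ m ∧ (∀ i ∈ F, ∀ j ∈ F, i ≤ j → ∀ x, m ≤ x → x ∈ T j → x ∈ T i) ∧
    ∀ k < m, ∀ i ∈ F, nextMem (T i) k < M

theorem IsCondition.exists_isBound {T : Ordinal.{0} → Set ℕ} (hT : IsOmega1Tower T)
    {F : Finset Ordinal.{0}} (hF : IsCondition T F) : ∃ m M, IsBound T F m M := by
  obtain ⟨m, h⟩ := hT.exists_tail hF.1
  let m' := max m (2 * F.card)
  refine ⟨m', ((Finset.range m' ×ˢ F).sup fun p => nextMem (T p.2) p.1) + 1, le_max_right _ _,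
    fun i hi j hj hij x hx => h i hi j hj hij x ((le_max_left _ _).trans hx), fun k hk i hi => ?_⟩
  exact Nat.lt_succ_of_le (Finset.le_sup (f := fun p : ℕ × Ordinal => nextMem (T p.2) p.1)
    (Finset.mem_product.2 ⟨Finset.mem_range.2 hk, hi⟩ : (k, i) ∈ Finset.range m' ×ˢ F))

theorem exists_same_trace {T : Ordinal.{0} → Set ℕ} {F G : Finset Ordinal.{0}} {M : ℕ}
    (h : traces T F M = traces T G M) {j : Ordinal} (hj : j ∈ G) :
    ∃ i ∈ F, ∀ x < M, x ∈ T i ↔ x ∈ T j := by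
  classical
  have : (Finset.range M).filter (· ∈ T j) ∈ traces T F M := by
    rw [h]
    exact Finset.mem_image_of_mem (fun i => (Finset.range M).filter (· ∈ T i)) hj
  obtain ⟨i, hi, h⟩ := Finset.mem_image.1 this
  refine ⟨i, hi, fun x hx => ?_⟩
  simpa [hx] using Finset.ext_iff.1 h x

theorem nextMem_eq_of_same_trace {A B : Set ℕ} (hA : A.Infinite) (hB : B.Infinite) {M k : ℕ}
    (h : ∀ x < M, x ∈ A ↔ x ∈ B) (hAM : nextMem A k < M) (hBM : nextMem B k < M) :
    nextMem A k = nextMem B k :=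
  le_antisymm
    (nextMem_le ((h _ hBM).2 (nextMem_spec hB k).1) (nextMem_spec hB k).2)
    (nextMem_le ((h _ hAM).1 (nextMem_spec hA k).1) (nextMem_spec hA k).2)

/-- The union of two conditions with the same bounds and traces is a condition. -/
theorem IsCondition.union {T : Ordinal.{0} → Set ℕ} (hT : IsOmega1Tower T)
    {F G : Finset Ordinal.{0}} (hF : IsCondition T F) (hG : IsCondition T G) {m M : ℕ}
    (hFb : IsBound T F m M) (hGb : IsBound T G m M) (h : traces T F M = traces T G M) :
    IsCondition T (F ∪ G) := by
  refine ⟨by simpa using ⟨hF.1, hG.1⟩, fun k => ?_⟩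
  obtain hk | hk := lt_or_ge k m
  · have hcopy : ∀ j ∈ F ∪ G, ∃ i ∈ F, (∀ x < M, x ∈ T i ↔ x ∈ T j) ∧
        nextMem (T i) k = nextMem (T j) k := by
      intro j hj
      obtain hj | hj := Finset.mem_union.1 hj
      · exact ⟨j, hj, fun _ _ => Iff.rfl, rfl⟩
      · obtain ⟨i, hi, hij⟩ := exists_same_trace h hj
        exact ⟨i, hi, hij, nextMem_eq_of_same_trace (hT.infinite i (hF.1 hi))
          (hT.infinite j (hG.1 hj)) hij (hFb.2.2 k hk i hi) (hGb.2.2 k hk j hj)⟩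
    choose! copy hcopyF hcopyT hcopyk using hcopy
    refine ⟨(Finset.card_le_card fun x hx => ?_).trans (hF.2 k).1, fun H hH hne => ?_⟩
    · obtain ⟨j, hj, rfl⟩ := Finset.mem_image.1 hx
      exact Finset.mem_image.2 ⟨copy j, hcopyF j hj, hcopyk j hj⟩
    · have hHF : H.image copy ⊆ F := Finset.image_subset_iff.2 fun j hj => hcopyF j (hH hj)
      have hvalues : ∀ x ∈ nextValues T (H.image copy) k, x < M ∧ x ∈ nextValues T H k := by
        intro x hx
        obtain ⟨i, hi, rfl⟩ := Finset.mem_image.1 hx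
        obtain ⟨j, hj, rfl⟩ := Finset.mem_image.1 hi
        exact ⟨hFb.2.2 k hk _ (hHF hi), Finset.mem_image.2 ⟨j, hj, (hcopyk j (hH hj)).symm⟩⟩
      obtain ⟨a, ha, b, hb, hab⟩ := (hF.2 k).2 _ hHF (hne.image copy)
      refine ⟨a, (hvalues a ha).2, b, (hvalues b hb).2, fun j hj => ?_⟩
      exact (hab _ (Finset.mem_image_of_mem copy hj)).imp
        (hcopyT j (hH hj) a (hvalues a ha).1).1 (hcopyT j (hH hj) b (hvalues b hb).1).1
  · refine ⟨?_, fun H hH hne => ?_⟩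
    · have h0 : (nextValues T (F ∪ G) k).card ≤ (F ∪ G).card := Finset.card_image_le
      have h1 := Finset.card_union_le F G
      have h2 := hFb.1
      have h3 := hGb.1
      omega
    · by_cases hHF : H ⊆ F
      · exact (hF.2 k).2 H hHF hne
      by_cases hHG : H ⊆ G
      · exact (hG.2 k).2 H hHG hne
      have hneF : (H ∩ F).Nonempty := by
        obtain ⟨i, hi, hiG⟩ := Finset.not_subset.1 hHG
        exact ⟨i, Finset.mem_inter.2 ⟨hi, (Finset.mem_union.1 (hH hi)).resolve_right hiG⟩⟩
      have hneG : (H ∩ G).Nonempty := by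
        obtain ⟨i, hi, hiF⟩ := Finset.not_subset.1 hHF
        exact ⟨i, Finset.mem_inter.2 ⟨hi, (Finset.mem_union.1 (hH hi)).resolve_left hiF⟩⟩
      obtain ⟨hiH, hiF⟩ := Finset.mem_inter.1 ((H ∩ F).max'_mem hneF)
      obtain ⟨hjH, hjG⟩ := Finset.mem_inter.1 ((H ∩ G).max'_mem hneG)
      have hi := nextMem_spec (hT.infinite _ (hF.1 hiF)) k
      have hj := nextMem_spec (hT.infinite _ (hG.1 hjG)) k
      refine ⟨_, Finset.mem_image_of_mem (fun i => nextMem (T i) k) hiH,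
        _, Finset.mem_image_of_mem (fun i => nextMem (T i) k) hjH, fun l hl => ?_⟩
      exact (Finset.mem_union.1 (hH hl)).imp
        (fun hlF => hFb.2.1 l hlF _ hiF
          ((H ∩ F).le_max' l (Finset.mem_inter.2 ⟨hl, hlF⟩)) _ (hk.trans hi.2) hi.1)
        (fun hlG => hGb.2.1 l hlG _ hjG
          ((H ∩ G).le_max' l (Finset.mem_inter.2 ⟨hl, hlG⟩)) _ (hk.trans hj.2) hj.1)

/-- Conditions, ordered by reverse inclusion. -/
abbrev Condition (T : Ordinal.{0} → Set ℕ) : Type 1 :=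
  {F : Finset Ordinal.{0} // IsCondition T F}ᵒᵈ

theorem stationarilyKnaster_condition {T : Ordinal.{0} → Set ℕ} (hT : IsOmega1Tower T) :
    StationarilyKnaster (Condition T) := by
  choose m M hb using fun p : Condition T => (OrderDual.ofDual p).2.exists_isBound hT
  refine stationarilyKnaster_of_countable_linked
    (fun p => (m p, M p, traces T (OrderDual.ofDual p).1 (M p))) fun p q hpq => ?_
  simp only [Prod.mk.injEq] at hpq
  obtain ⟨hm, hM, htr⟩ := hpq
  have hq := hb q
  rw [← hm, ← hM] at hq
  rw [← hM] at htr
  exact ⟨OrderDual.toDual ⟨_, (OrderDual.ofDual p).2.union hT (OrderDual.ofDual q).2 (hb p) hq htr⟩,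
    OrderDual.toDual_le.2 Finset.subset_union_left, OrderDual.toDual_le.2 Finset.subset_union_right⟩

/-- A nonempty part of a tower all of whose finite subsets are conditions is met, for each `k`,
by two numbers that are at least `k`. -/
theorem exists_pair_of_finite_subsets {T : Ordinal.{0} → Set ℕ} (hT : IsOmega1Tower T)
    {X : Set Ordinal.{0}} (hne : X.Nonempty) (hX : X ⊆ Iio omega1)
    (hfin : ∀ F : Finset Ordinal.{0}, ↑F ⊆ X → IsCondition T F) (k : ℕ) :
    ∃ a b, k ≤ a ∧ k ≤ b ∧ ∀ i ∈ X, a ∈ T i ∨ b ∈ T i := by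
  by_contra! hno
  let V : Set ℕ := (fun i => nextMem (T i) k) '' X
  have hV : V.Finite := by
    by_contra hinf
    obtain ⟨W, hWV, hW⟩ := Set.Infinite.exists_subset_card_eq hinf (k + 2)
    obtain ⟨F, hFX, rfl⟩ := Finset.subset_set_image_iff.1 hWV
    have h := ((hfin F hFX).2 k).1
    unfold nextValues at h
    omega
  have hge : ∀ a ∈ V, k ≤ a := by
    rintro _ ⟨i, hi, rfl⟩
    exact (nextMem_spec (hT.infinite i (hX hi)) k).2
  obtain ⟨i₀, hi₀⟩ := hne
  have hbad (a b : ℕ) : ∃ i ∈ X, a ∈ V → b ∈ V → a ∉ T i ∧ b ∉ T i := by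
    by_cases h : a ∈ V ∧ b ∈ V
    · obtain ⟨i, hi, h'⟩ := hno a b (hge a h.1) (hge b h.2)
      exact ⟨i, hi, fun _ _ => h'⟩
    · exact ⟨i₀, hi₀, fun h1 h2 => absurd ⟨h1, h2⟩ h⟩
  choose bad hbadX hbad using hbad
  let F : Finset Ordinal.{0} :=
    insert i₀ ((hV.toFinset ×ˢ hV.toFinset).image fun p => bad p.1 p.2)
  have hFX : ↑F ⊆ X := by
    intro i hi
    obtain rfl | hi := Finset.mem_insert.1 hi
    · exact hi₀
    · obtain ⟨p, -, rfl⟩ := Finset.mem_image.1 hi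
      exact hbadX _ _
  have hFV : ∀ a ∈ nextValues T F k, a ∈ V := by
    intro a ha
    obtain ⟨i, hi, rfl⟩ := Finset.mem_image.1 ha
    exact mem_image_of_mem _ (hFX hi)
  obtain ⟨a, ha, b, hb, hab⟩ := ((hfin F hFX).2 k).2 F Subset.rfl (Finset.insert_nonempty _ _)
  have ha := hFV a ha
  have hb := hFV b hb
  have hmem : bad a b ∈ F := Finset.mem_insert_of_mem (Finset.mem_image.2
    ⟨(a, b), Finset.mem_product.2 ⟨hV.mem_toFinset.2 ha, hV.mem_toFinset.2 hb⟩, rfl⟩)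
  have := hbad a b ha hb
  exact (hab _ hmem).elim this.1 this.2

/-- A cofinal part of a tower cannot be met by pairs of arbitrarily large numbers. -/
theorem IsOmega1Tower.not_exists_pairs {T : Ordinal.{0} → Set ℕ} (hT : IsOmega1Tower T)
    {X : Set Ordinal.{0}} (hX : X ⊆ Iio omega1) (hunb : ∀ α < omega1, ∃ β ∈ X, α < β) :
    ¬ ∀ k, ∃ a b, k ≤ a ∧ k ≤ b ∧ ∀ i ∈ X, a ∈ T i ∨ b ∈ T i := by
  intro h
  choose a b ha hb hab using h
  have key {A : Set ℕ} (hA : A.Infinite) {α : Ordinal} (hα : α < omega1)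
      (hAX : ∀ i ∈ X, α < i → (A \ T i).Finite) : False := by
    refine hT.no_pseudoIntersection ⟨A, hA, fun i hi => ?_⟩
    obtain ⟨j, hj, hij⟩ := hunb _ (max_lt hα hi)
    have h1 := hAX j hj ((le_max_left _ _).trans_lt hij)
    have h2 := hT.almost_subset i j ((le_max_right _ _).trans hij.le) (hX hj)
    exact finite_diff_trans h1 h2
  have himage {f : ℕ → ℕ} (hf : ∀ k, k ≤ f k) {K : Set ℕ} (hK : K.Infinite) :
      (f '' K).Infinite := by
    refine infinite_of_not_bddAbove fun ⟨N, hN⟩ => hK ((finite_Iic N).subset fun k hk => ?_)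
    exact (hf k).trans (hN (mem_image_of_mem f hk))
  by_cases hcase : ∀ i ∈ X, {k | a k ∉ T i}.Finite
  · have h0 : (0 : Ordinal) < omega1 := omega1_eq ▸ Ordinal.omega_pos 1
    refine key (himage ha infinite_univ) h0 fun i hi _ => ((hcase i hi).image a).subset ?_
    rintro _ ⟨⟨k, -, rfl⟩, hk⟩
    exact mem_image_of_mem a hk
  · push Not at hcase
    obtain ⟨α, hα, hK⟩ := hcase
    refine key (himage hb hK) (hX hα) fun i hi hαi => ?_
    obtain ⟨N, hN⟩ := (hT.almost_subset α i hαi.le (hX hi)).bddAbove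
    refine ((finite_Iic N).image b).subset ?_
    rintro _ ⟨⟨k, hk, rfl⟩, hki⟩
    exact mem_image_of_mem b ((ha k).trans (hN ⟨(hab k i hi).resolve_right hki, hk⟩))

theorem not_stationaryPrecaliber_condition {T : Ordinal.{0} → Set ℕ} (hT : IsOmega1Tower T) :
    ¬ StationaryPrecaliber (Condition T) := by
  classical
  intro hP
  have h0 : (0 : Ordinal) < omega1 := omega1_eq ▸ Ordinal.omega_pos 1
  let p : Ordinal → Condition T := fun i =>
    if hi : i < omega1 then OrderDual.toDual ⟨{i}, isCondition_singleton hT hi⟩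
    else OrderDual.toDual ⟨{0}, isCondition_singleton hT h0⟩
  have hp {i : Ordinal} (hi : i < omega1) : (OrderDual.ofDual (p i)).1 = {i} := by
    simp [p, hi]
  obtain ⟨X, -, hX, hcent⟩ := hP _ isStationaryOmega1_Iio p
  refine hT.not_exists_pairs hX.1 (fun α hα => hX.exists_gt hα)
    (exists_pair_of_finite_subsets hT ?_ hX.1 fun F hF => ?_)
  · obtain ⟨β, hβ, -⟩ := hX.exists_gt h0
    exact ⟨β, hβ⟩
  · obtain ⟨r, hr⟩ := hcent (F.image p) (by
      rw [Finset.coe_image]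
      exact image_mono hF)
    refine (OrderDual.ofDual r).2.mono fun i hi => ?_
    have h1 : (OrderDual.ofDual (p i)).1 ⊆ (OrderDual.ofDual r).1 :=
      hr _ (Finset.mem_image_of_mem p hi)
    rw [hp (hX.1 (hF hi))] at h1
    exact h1 (Finset.mem_singleton_self i)

/-- If 𝔱 = ω₁ then there is a partial order which is stationarily Knaster but
does not have stationary precaliber ω₁. -/
theorem tower_omega1_implies_statKnaster_not_statPrecaliber
    (hexists : ∃ 𝒯 : Set (Set ℕ), IsTowerFamily 𝒯 ∧ Cardinal.mk ↥𝒯 = Cardinal.aleph 1)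
    (hleast : ∀ 𝒯 : Set (Set ℕ), IsTowerFamily 𝒯 → Cardinal.aleph 1 ≤ Cardinal.mk ↥𝒯) :
    ∃ (P : Type 1) (inst : PartialOrder P),
      @StationarilyKnaster P inst ∧ ¬ @StationaryPrecaliber P inst := by
  obtain ⟨T, hT⟩ := exists_isOmega1Tower hexists hleast
  exact ⟨Condition T, inferInstance, stationarilyKnaster_condition hT,
    not_stationaryPrecaliber_condition hT⟩
end
end

section
/- Let T be a tree of height ω₁ with no uncountable chains and ⟨x_α : α < ω₁⟩ a pairwise disjoint sequence of finite subsets of T. Let Y ⊆ ω₁ be uncountable and let 𝒵 be a countable collection of subsets of ω₁. Then there are uncountably many ξ ∈ Y with the property that for every Z ∈ 𝒵 with ξ ∈ Z, there are uncountably many j ∈ Z such that every member of x_ξ is incomparable in T with every member of x_j. -/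
noncomputable section

open Set

/-- A tree: the predecessors of every element are well-ordered. -/
def IsTree (T : Type) [PartialOrder T] : Prop :=
  ∀ x : T, IsWellOrder {y : T // y < x} (fun a b => (a : T) < (b : T))

/-- The height of a node: the order type of its set of predecessors. -/
def treeHt {T : Type} [PartialOrder T] (h : IsTree T) (x : T) : Ordinal :=
  @Ordinal.type {y : T // y < x} (fun a b => (a : T) < (b : T)) (h x)

/-- If every element of an uncountable set satisfies one of countably many properties, then
one of these properties holds on an uncountable subset. -/
theorem exists_not_countable_sep {ι κ : Type*} [Countable κ] {W : Set ι} (hW : ¬ W.Countable)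
    {P : ι → κ → Prop} (hP : ∀ w ∈ W, ∃ k, P w k) : ∃ k, ¬ {w | w ∈ W ∧ P w k}.Countable := by
  by_contra! h
  refine hW ((countable_iUnion h).mono fun w hw => ?_)
  obtain ⟨k, hk⟩ := hP w hw
  exact mem_iUnion.2 ⟨k, hw, hk⟩

/-- Only countably many members of a pairwise disjoint family meet a given countable set. -/
theorem countable_setOf_exists_mem {ι T : Type*} {x : ι → Finset T} {W : Set ι}
    (hdisj : W.PairwiseDisjoint x) {S : Set T} (hS : S.Countable) :
    {j | j ∈ W ∧ ∃ b ∈ x j, b ∈ S}.Countable := by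
  have : {j | j ∈ W ∧ ∃ b ∈ x j, b ∈ S} ⊆ ⋃ b ∈ S, {j | j ∈ W ∧ b ∈ x j} := by
    rintro j ⟨hj, b, hb, hbS⟩
    exact mem_biUnion hbS ⟨hj, hb⟩
  refine (hS.biUnion fun b _ => Set.Subsingleton.countable ?_).mono this
  rintro i ⟨hi, hbi⟩ j ⟨hj, hbj⟩
  exact hdisj.elim_finset hi hj b hbi hbj

/-- A strong form of the Baumgartner–Malitz–Reinhardt theorem: an uncountable pairwise disjoint
family of finite sets of nodes has a member that is completely incomparable with uncountably
many members. -/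
theorem exists_not_countable_incomparable {ι T : Type*} [PartialOrder T]
    (hcmp : ∀ a b c : T, a < c → b < c → a ≤ b ∨ b ≤ a)
    (hpred : ∀ a : T, (Iic a).Countable)
    (hchains : ∀ C : Set T, IsChain (· ≤ ·) C → C.Countable)
    {x : ι → Finset T} {W : Set ι} (hdisj : W.PairwiseDisjoint x) (hW : ¬ W.Countable) :
    ∃ ξ ∈ W, ¬ {j | j ∈ W ∧ ∀ a ∈ x ξ, ∀ b ∈ x j, ¬ a ≤ b ∧ ¬ b ≤ a}.Countable := by
  by_contra! hbad
  obtain ⟨n, hn⟩ := exists_not_countable_sep (P := fun w n => (x w).card = n) hW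
    fun w _ => ⟨_, rfl⟩
  set V := {w | w ∈ W ∧ (x w).card = n}
  have hVW : V ⊆ W := fun _ h => h.1
  have hne : (Filter.cocountable ⊓ Filter.principal V).NeBot := by
    rw [Filter.inf_principal_neBot_iff]
    intro U hU
    rw [Filter.mem_cocountable] at hU
    by_contra h
    exact hn (hU.mono fun v hv hvU => h ⟨v, hvU, hv⟩)
  obtain ⟨u, hu⟩ := Ultrafilter.exists_le (Filter.cocountable ⊓ Filter.principal V)
  have huV : ∀ᶠ j in (u : Filter ι), j ∈ V :=
    (hu.trans inf_le_right) (Filter.mem_principal_self V)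
  have huc : ∀ S : Set ι, S.Countable → ∀ᶠ j in (u : Filter ι), j ∉ S := fun S hS =>
    (hu.trans inf_le_left) (Filter.mem_cocountable.2 (by rwa [← compl_def, compl_compl]))
  have key : ∀ ξ ∈ V, ∃ l : Fin n, ∃ a ∈ x ξ,
      ∀ᶠ j in (u : Filter ι), ∃ b, (x j).toList[(l : ℕ)]? = some b ∧ a < b := by
    intro ξ hξ
    have h₁ := huc _ (hbad ξ hξ.1)
    have h₂ := huc _ (countable_setOf_exists_mem hdisj
      ((x ξ).countable_toSet.biUnion fun a _ => hpred a))
    have h₃ : ∀ᶠ j in (u : Filter ι), ∃ l : Fin n, ∃ a ∈ (x ξ : Set T),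
        ∃ b, (x j).toList[(l : ℕ)]? = some b ∧ a < b := by
      filter_upwards [h₁, h₂, huV] with j hj₁ hj₂ hjV
      have : ∃ a ∈ x ξ, ∃ b ∈ x j, a < b := by
        by_contra! hlt
        refine hj₁ ⟨hjV.1, fun a ha b hb => ?_⟩
        have hba : ¬ b ≤ a := fun hle => hj₂ ⟨hjV.1, b, hb, mem_biUnion ha hle⟩
        exact ⟨fun hab => hlt a ha b hb (lt_of_le_not_ge hab hba), hba⟩
      obtain ⟨a, ha, b, hb, hab⟩ := this
      obtain ⟨l, hl, rfl⟩ := List.getElem_of_mem (Finset.mem_toList.2 hb)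
      have hln : l < n := by rwa [Finset.length_toList, hjV.2] at hl
      exact ⟨⟨l, hln⟩, a, ha, _, List.getElem?_eq_getElem hl, hab⟩
    obtain ⟨l, hl⟩ := Ultrafilter.eventually_exists_iff.1 h₃
    obtain ⟨a, ha, h⟩ := (Ultrafilter.eventually_exists_mem_iff (x ξ).finite_toSet).1 hl
    exact ⟨l, a, ha, h⟩
  obtain ⟨l, hl⟩ := exists_not_countable_sep hn key
  have hchoice : ∀ ξ : {ξ | ξ ∈ V ∧ ∃ a ∈ x ξ,
      ∀ᶠ j in (u : Filter ι), ∃ b, (x j).toList[(l : ℕ)]? = some b ∧ a < b}, ∃ a ∈ x ξ,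
      ∀ᶠ j in (u : Filter ι), ∃ b, (x j).toList[(l : ℕ)]? = some b ∧ a < b := fun ξ => ξ.2.2
  choose f hfx hf using hchoice
  have hinj : Function.Injective f := fun ξ η h =>
    Subtype.ext (hdisj.elim_finset (hVW ξ.2.1) (hVW η.2.1) (f ξ) (hfx ξ) (h ▸ hfx η))
  have hchain : IsChain (· ≤ ·) (range f) := by
    rintro _ ⟨ξ, rfl⟩ _ ⟨η, rfl⟩ -
    obtain ⟨j, ⟨b, hb, hξb⟩, c, hc, hηc⟩ := ((hf ξ).and (hf η)).exists
    obtain rfl : b = c := Option.some.inj (hb.symm.trans hc)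
    exact hcmp _ _ _ hξb hηc
  have := (hchains _ hchain).to_subtype
  exact hl (countable_coe_iff.1 ((rangeFactorization_injective.2 hinj).countable))

theorem IsTree.le_or_le_of_lt_of_lt {T : Type} [PartialOrder T] (h : IsTree T) {a b c : T}
    (ha : a < c) (hb : b < c) : a ≤ b ∨ b ≤ a := by
  have := h c
  rcases trichotomous_of (fun a b : {y : T // y < c} => (a : T) < (b : T)) ⟨a, ha⟩ ⟨b, hb⟩
    with hlt | heq | hlt
  · exact Or.inl hlt.le
  · exact Or.inl (congrArg Subtype.val heq).le
  · exact Or.inr hlt.le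

theorem countable_Iic_of_treeHt_lt {T : Type} [PartialOrder T] (h : IsTree T) {a : T}
    (ha : treeHt h a < omega1) : (Iic a).Countable := by
  have := h a
  rw [omega1, Cardinal.lt_ord, treeHt, Ordinal.card_type] at ha
  have hIio : (Iio a).Countable := Cardinal.le_aleph0_iff_set_countable.1 (Cardinal.lt_aleph_one_iff.1 ha)
  rw [← Iio_insert]
  exact hIio.insert a

/-- Given a pairwise disjoint sequence of finite subsets of a tree of height ω₁
with no uncountable chains, an uncountable Y ⊆ ω₁, and a countable collection 𝒵
of subsets of ω₁, uncountably many ξ ∈ Y satisfy: for every Z ∈ 𝒵 containing ξ,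
there are uncountably many j ∈ Z with x_ξ completely incomparable to x_j. -/
theorem uncountably_many_good_indices
    (T : Type) [PartialOrder T] (htree : IsTree T)
    (hlt : ∀ x : T, treeHt htree x < omega1)
    (hunb : ∀ α < omega1, ∃ x : T, treeHt htree x = α)
    (hchains : ∀ C : Set T, IsChain (· ≤ ·) C → C.Countable)
    (x : Ordinal → Finset T)
    (hdisj : ∀ α < omega1, ∀ β < omega1, α ≠ β → Disjoint (x α) (x β))
    (Y : Set Ordinal) (hY : Y ⊆ Set.Iio omega1) (hYunc : ¬ Y.Countable)
    (𝒵 : Set (Set Ordinal)) (h𝒵 : 𝒵.Countable) (h𝒵sub : ∀ Z ∈ 𝒵, Z ⊆ Set.Iio omega1) :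
    ¬ Set.Countable {ξ | ξ ∈ Y ∧ ∀ Z ∈ 𝒵, ξ ∈ Z →
        ¬ Set.Countable {j | j ∈ Z ∧ ∀ a ∈ x ξ, ∀ b ∈ x j, ¬ a ≤ b ∧ ¬ b ≤ a}} := by
  intro hgood
  have hbad : ¬ (Y \ {ξ | ξ ∈ Y ∧ ∀ Z ∈ 𝒵, ξ ∈ Z →
      ¬ Set.Countable {j | j ∈ Z ∧ ∀ a ∈ x ξ, ∀ b ∈ x j, ¬ a ≤ b ∧ ¬ b ≤ a}}).Countable :=
    fun h => hYunc ((h.union hgood).mono fun ξ hξ => by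
      by_cases hg : ξ ∈ {ξ | ξ ∈ Y ∧ ∀ Z ∈ 𝒵, ξ ∈ Z →
        ¬ Set.Countable {j | j ∈ Z ∧ ∀ a ∈ x ξ, ∀ b ∈ x j, ¬ a ≤ b ∧ ¬ b ≤ a}}
      · exact Or.inr hg
      · exact Or.inl ⟨hξ, hg⟩)
  have := h𝒵.to_subtype
  obtain ⟨Z, hZ⟩ := exists_not_countable_sep (κ := 𝒵) hbad
    (P := fun ξ Z => ξ ∈ Z.1 ∧
      {j | j ∈ Z.1 ∧ ∀ a ∈ x ξ, ∀ b ∈ x j, ¬ a ≤ b ∧ ¬ b ≤ a}.Countable) (by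
      rintro ξ ⟨hξ, hng⟩
      by_contra! h
      exact hng ⟨hξ, fun Z hZ hξZ => h ⟨Z, hZ⟩ hξZ⟩)
  obtain ⟨ξ, hξ, hunc⟩ := exists_not_countable_incomparable (x := x)
    (fun _ _ _ => htree.le_or_le_of_lt_of_lt)
    (fun a => countable_Iic_of_treeHt_lt htree (hlt a)) hchains
    (fun α hα β hβ => hdisj α (hY hα.1.1) β (hY hβ.1.1)) hZ
  refine hunc (hξ.2.2.mono ?_)
  rintro j ⟨hj, hinc⟩
  exact ⟨hj.2.1, hinc⟩
end
end
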